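/- Let T_r be the path graph on vertices {1,…,r+1} with edges {i,i+1} for 1 ≤ i ≤ r, where r ≥ 1. Order the minimal monomial generators of I(T_r) as u_1 >_lex u_2 >_lex ⋯ >_lex u_R (R = 2^r) in the lexicographic order with s_{1,2} > s_{2,3} > ⋯ > s_{r,r+1} > t_{1,2} > ⋯ > t_{r,r+1}. Then for every k with 2 ≤ k ≤ R, the colon ideal (u_1, …, u_{k−1}) : u_k equals the ideal generated by the set of variables { s_{i,i+1} : t_{i,i+1} divides u_k }. -/

import Mathlib

open MvPolynomial

/-- Indicator: does the edge `e` cross the partition `A | Aᶜ`? -/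
def crossBool {V : Type} [DecidableEq V] (A : Finset V) : Sym2 V → Bool :=
  Sym2.lift ⟨fun i j => xor (decide (i ∈ A)) (decide (j ∈ A)), fun i j => Bool.xor_comm _ _⟩

/-- The cut monomial `u_{A|B}` (with `B = Aᶜ`), formed from the edges in `E'`,
viewed in the polynomial ring `S` on variables `s_e = X (e, true)`, `t_e = X (e, false)`
indexed by the edges of the ambient graph `G`. -/
noncomputable def cutGen (k : Type) [Field k] {V : Type} [DecidableEq V]
    (G : SimpleGraph V) (E' : Finset (Sym2 V)) (hE' : ↑E' ⊆ G.edgeSet) (A : Finset V) :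
    MvPolynomial (↥G.edgeSet × Bool) k :=
  ∏ e ∈ E'.attach, X (⟨⟨e.1, hE' e.2⟩, crossBool A e.1⟩ : ↥G.edgeSet × Bool)

/-- The monomial cut ideal of the subgraph of `G` with edge set `E'`,
viewed as an ideal of the polynomial ring associated to `G`. -/
noncomputable def cutIdealOn (k : Type) [Field k] {V : Type} [DecidableEq V]
    (G : SimpleGraph V) (E' : Finset (Sym2 V)) (hE' : ↑E' ⊆ G.edgeSet) :
    Ideal (MvPolynomial (↥G.edgeSet × Bool) k) :=
  Ideal.span (Set.range (cutGen k G E' hE'))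

/-- The monomial cut ideal `I(G)` of the graph `G`. -/
noncomputable def cutIdeal (k : Type) [Field k] {V : Type} [DecidableEq V]
    (G : SimpleGraph V) [Fintype G.edgeSet] :
    Ideal (MvPolynomial (↥G.edgeSet × Bool) k) :=
  cutIdealOn k G G.edgeSet.toFinset (by simp)

/-- The rank of a variable of the polynomial ring of the path graph `T_r` in the order
`s_{1,2} > s_{2,3} > ⋯ > s_{r,r+1} > t_{1,2} > ⋯ > t_{r,r+1}`: variables of smaller
rank are larger.  The edge `{i, i+1}` is recorded by its smaller endpoint `i`. -/
def pathVarRank (r : ℕ) (v : ↥(SimpleGraph.pathGraph (r + 1)).edgeSet × Bool) : ℕ :=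
  (cond v.2 0 r) + (Sym2.inf v.1.1 : Fin (r + 1))

/-- `m >_lex m'` for two monomials with exponent vectors `d` and `d'`, with respect to the
variable order given by `rank` (smaller rank = larger variable): at the most significant
variable where the exponents differ, `d` is larger. -/
def LexGT {σ : Type} (rank : σ → ℕ) (d d' : σ →₀ ℕ) : Prop :=
  ∃ v, d' v < d v ∧ ∀ w, rank w < rank v → d w = d' w

noncomputable def cutExp {σ : Type} [Fintype σ] (f : σ → Bool) : (σ × Bool) →₀ ℕ :=
  ∑ e, Finsupp.single (e, f e) 1

lemma cutExp_apply {σ : Type} [Fintype σ] (f : σ → Bool) (e : σ) (b : Bool) :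
    cutExp f (e, b) = if f e = b then 1 else 0 := by
  classical
  unfold cutExp
  rw [Finsupp.finsetSum_apply, Finset.sum_eq_single e]
  · simp [Finsupp.single_apply]
  · intro e' _ h
    simp [Finsupp.single_apply, h]
  · simp

lemma cutGen_eq (k : Type) [Field k] {V : Type} [DecidableEq V]
    (G : SimpleGraph V) [Fintype G.edgeSet] (h : ↑G.edgeSet.toFinset ⊆ G.edgeSet) (A : Finset V) :
    cutGen k G G.edgeSet.toFinset h A =
      monomial (cutExp (fun e : G.edgeSet => crossBool A e.1)) 1 := by
  unfold cutGen cutExp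
  rw [monomial_sum_one]
  refine Finset.prod_bij (fun e _ => ⟨e.1, h e.2⟩) ?_ ?_ ?_ ?_
  · simp
  · intro a _ b _ hab
    exact Subtype.ext (Subtype.mk.inj hab)
  · intro b _
    exact ⟨⟨b.1, by simp⟩, by simp, rfl⟩
  · intro a _
    rfl

def parAux (F : ℕ → Bool) : ℕ → Bool
  | 0 => false
  | n + 1 => xor (parAux F n) (F n)

lemma exists_cut (r : ℕ) (f : (SimpleGraph.pathGraph (r + 1)).edgeSet → Bool) :
    ∃ A : Finset (Fin (r + 1)), ∀ e : (SimpleGraph.pathGraph (r + 1)).edgeSet,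
      crossBool A e.1 = f e := by
  classical
  let F : ℕ → Bool := fun n => if h : ∃ e : (SimpleGraph.pathGraph (r + 1)).edgeSet,
    ((Sym2.inf e.1 : Fin (r + 1)) : ℕ) = n then f h.choose else false
  have key : ∀ a b : Fin (r + 1), (a : ℕ) + 1 = b →
      ∀ h : s(a, b) ∈ (SimpleGraph.pathGraph (r + 1)).edgeSet, F a = f ⟨s(a, b), h⟩ := by
    intro a b hab h
    have hlt : a ≤ b := by rw [Fin.le_def]; omega
    have hex : ∃ e : (SimpleGraph.pathGraph (r + 1)).edgeSet,
        ((Sym2.inf e.1 : Fin (r + 1)) : ℕ) = a := ⟨⟨s(a, b), h⟩, by simp [hlt]⟩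
    have hF : F a = f hex.choose := dif_pos hex
    rw [hF]
    congr 1
    have hs := hex.choose_spec
    revert hs
    generalize hex.choose = e
    obtain ⟨e, he⟩ := e
    induction e using Sym2.ind with
    | _ x y =>
      intro hs
      rw [SimpleGraph.mem_edgeSet, SimpleGraph.pathGraph_adj] at he
      simp only [Sym2.inf_mk] at hs
      apply Subtype.ext
      simp only [Sym2.eq_iff, Fin.ext_iff]
      rcases he with he | he
      · have : x ≤ y := by rw [Fin.le_def]; omega
        rw [inf_eq_left.2 this] at hs
        omega
      · have : y ≤ x := by rw [Fin.le_def]; omega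
        rw [inf_eq_right.2 this] at hs
        omega
  refine ⟨Finset.univ.filter (fun v => parAux F v = true), ?_⟩
  have key2 : ∀ a b : Fin (r + 1), (a : ℕ) + 1 = b →
      ∀ h : s(a, b) ∈ (SimpleGraph.pathGraph (r + 1)).edgeSet,
      crossBool (Finset.univ.filter (fun v : Fin (r + 1) => parAux F v = true)) s(a, b)
        = f ⟨s(a, b), h⟩ := by
    intro a b hab h
    rw [← key a b hab h]
    simp only [crossBool, Sym2.lift_mk, Finset.mem_filter, Finset.mem_univ, true_and,
      Bool.decide_eq_true, ← hab, parAux]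
    cases parAux F a <;> simp
  rintro ⟨e, he⟩
  induction e using Sym2.ind with
  | _ x y =>
    have he' := he
    rw [SimpleGraph.mem_edgeSet, SimpleGraph.pathGraph_adj] at he'
    rcases he' with h | h
    · exact key2 x y h he
    · have h2 : s(x, y) = s(y, x) := Sym2.eq_swap
      have := key2 y x h (h2 ▸ he)
      simpa only [h2] using this

/-- Order the minimal monomial generators of `I(T_r)` (`r ≥ 1`) decreasingly,
`u_0 >_lex u_1 >_lex ⋯ >_lex u_{R-1}` with `R = 2^r`, in the lexicographic order with
`s_{1,2} > ⋯ > s_{r,r+1} > t_{1,2} > ⋯ > t_{r,r+1}`.  Then for every `p ≥ 1`, the colon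
ideal `(u_0, …, u_{p-1}) : u_p` is generated by the variables
`{ s_{i,i+1} : t_{i,i+1} divides u_p }`. -/
theorem monomial_cut_ideal_pathGraph_set_eq
    (k : Type) [Field k] (r : ℕ) (hr : 1 ≤ r)
    [DecidableRel (SimpleGraph.pathGraph (r + 1)).Adj]
    [Fintype (SimpleGraph.pathGraph (r + 1)).edgeSet]
    (d : Fin (2 ^ r) → ((↥(SimpleGraph.pathGraph (r + 1)).edgeSet × Bool) →₀ ℕ))
    (hgen : Set.range (fun i => (monomial (d i) 1 :
        MvPolynomial (↥(SimpleGraph.pathGraph (r + 1)).edgeSet × Bool) k)) =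
      Set.range (cutGen k (SimpleGraph.pathGraph (r + 1))
        (SimpleGraph.pathGraph (r + 1)).edgeSet.toFinset (by simp)))
    (hlex : ∀ i j : Fin (2 ^ r), i < j → LexGT (pathVarRank r) (d i) (d j)) :
    ∀ p : Fin (2 ^ r), 0 < (p : ℕ) →
      Submodule.colon
          (Ideal.span {x | ∃ i, i < p ∧ x = (monomial (d i) 1 :
            MvPolynomial (↥(SimpleGraph.pathGraph (r + 1)).edgeSet × Bool) k)})
          (Ideal.span {(monomial (d p) 1 :
            MvPolynomial (↥(SimpleGraph.pathGraph (r + 1)).edgeSet × Bool) k)}) =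
        Ideal.span
          ((fun e : ↥(SimpleGraph.pathGraph (r + 1)).edgeSet =>
              (X (e, true) : MvPolynomial (↥(SimpleGraph.pathGraph (r + 1)).edgeSet × Bool) k))
            '' {e | d p (e, false) ≠ 0}) := by
  classical
  intro p _
  have hd : ∀ i, ∃ f : (SimpleGraph.pathGraph (r + 1)).edgeSet → Bool, d i = cutExp f := by
    intro i
    have : (monomial (d i) 1 :
        MvPolynomial (↥(SimpleGraph.pathGraph (r + 1)).edgeSet × Bool) k) ∈ _ :=
      hgen ▸ Set.mem_range_self i
    obtain ⟨A, hA⟩ := this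
    rw [cutGen_eq] at hA
    exact ⟨_, (monomial_left_injective one_ne_zero hA).symm⟩
  have hsurj : ∀ f : (SimpleGraph.pathGraph (r + 1)).edgeSet → Bool, ∃ i, d i = cutExp f := by
    intro f
    obtain ⟨A, hA⟩ := exists_cut r f
    have := Set.mem_range_self (f := cutGen k (SimpleGraph.pathGraph (r + 1))
        (SimpleGraph.pathGraph (r + 1)).edgeSet.toFinset (by simp)) A
    rw [← hgen] at this
    obtain ⟨i, hi⟩ := this
    rw [cutGen_eq] at hi
    refine ⟨i, (monomial_left_injective one_ne_zero hi).trans ?_⟩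
    congr 1
    exact funext hA
  have hrank : ∀ e : (SimpleGraph.pathGraph (r + 1)).edgeSet,
      pathVarRank r (e, true) < pathVarRank r (e, false) := by
    intro e
    simp only [pathVarRank, cond_true, cond_false]
    omega
  have hset : {x | ∃ i, i < p ∧ x = (monomial (d i) 1 :
            MvPolynomial (↥(SimpleGraph.pathGraph (r + 1)).edgeSet × Bool) k)} =
      (fun s => monomial s 1) '' (d '' {i | i < p}) := by
    ext x
    constructor
    · rintro ⟨i, hi, rfl⟩
      exact ⟨_, ⟨i, hi, rfl⟩, rfl⟩
    · rintro ⟨_, ⟨i, hi, rfl⟩, rfl⟩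
      exact ⟨i, hi, rfl⟩
  obtain ⟨fp, hfp⟩ := hd p
  apply le_antisymm
  · intro x hx
    have hx' := (Submodule.mem_colon.1 hx) _ (Ideal.mem_span_singleton_self _)
    rw [smul_eq_mul, hset, mem_ideal_span_monomial_image] at hx'
    change x ∈ Ideal.span ((fun e => X (e, true)) '' {e | d p (e, false) ≠ 0})
    rw [show (fun e : ↥(SimpleGraph.pathGraph (r + 1)).edgeSet =>
              (X (e, true) : MvPolynomial (↥(SimpleGraph.pathGraph (r + 1)).edgeSet × Bool) k))
            '' {e | d p (e, false) ≠ 0} = X '' ((fun e => (e, true)) '' {e | d p (e, false) ≠ 0})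
      by rw [Set.image_image], mem_ideal_span_X_image]
    intro n hn
    obtain ⟨_, ⟨i, hi, rfl⟩, hle⟩ := hx' (n + d p) (by
      rw [mem_support_iff, coeff_mul_monomial, mul_one]
      exact mem_support_iff.1 hn)
    obtain ⟨fi, hfi⟩ := hd i
    obtain ⟨⟨e, b⟩, hv, hw⟩ := hlex i p hi
    have hle' := hle (e, true)
    rw [Finsupp.add_apply] at hle'
    have h2 := hw (e, true)
    have h3 := hrank e
    refine ⟨(e, true), ⟨e, ?_, rfl⟩, ?_⟩ <;>
    · simp only [Set.mem_ofPred_eq, hfp, hfi, cutExp_apply] at *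
      cases b <;> cases h5 : fi e <;> cases h6 : fp e <;> simp_all <;> omega
  · rw [Ideal.span_le]
    rintro _ ⟨e, he, rfl⟩
    obtain ⟨i, hi⟩ := hsurj (Function.update fp e true)
    have hpe : fp e = false := by
      by_contra h
      simp [hfp, cutExp_apply, h] at he
    have hip : i < p := by
      rcases lt_trichotomy i p with h | h | h
      · exact h
      · subst h
        have := DFunLike.congr_fun (hi.symm.trans hfp) (e, true)
        simp [cutExp_apply, hpe] at this
      · exfalso
        obtain ⟨⟨e', b⟩, hv, hw⟩ := hlex p i h
        have hee : e' = e := by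
          by_contra hne
          simp [hfp, hi, cutExp_apply, Function.update_of_ne hne] at hv
        subst hee
        have h2 := hw (e', true)
        have h3 := hrank e'
        cases b <;> simp_all [cutExp_apply]
    have hmul : (X (e, true) * monomial (d p) 1 :
        MvPolynomial (↥(SimpleGraph.pathGraph (r + 1)).edgeSet × Bool) k) =
        X (e, false) * monomial (d i) 1 := by
      rw [X, X, monomial_mul, monomial_mul]
      refine congrArg (fun n => monomial n _) ?_
      refine Finsupp.ext ?_
      rintro ⟨e', b⟩
      rw [hfp, hi, Finsupp.add_apply, Finsupp.add_apply, cutExp_apply, cutExp_apply]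
      by_cases hne : e' = e
      · subst hne
        cases b <;> simp [hpe, Finsupp.single_apply]
      · have hne' : ¬ e = e' := fun h => hne h.symm
        simp [Function.update_of_ne hne, Finsupp.single_apply, hne']
    refine Submodule.mem_colon.2 ?_
    intro y hy
    obtain ⟨z, rfl⟩ := Ideal.mem_span_singleton'.1 hy
    rw [smul_eq_mul, mul_left_comm, hmul]
    exact Ideal.mul_mem_left _ _ (Ideal.mul_mem_left _ _ (Ideal.subset_span ⟨i, hip, rfl⟩))
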